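/- Let μ₊ and μ₋ be probability measures on a measurable space X, let π ∈ [0,1], let μ = π·μ₊ + (1−π)·μ₋, and let f : X → ℝ be measurable. Then the NU AUC risk equals a linear transformation of the PN AUC risk: R_NU(f) = (1−π)/2 + π·R_PN(f), where R_NU(f) = ∫∫ l01(f(x), f(x')) dμ₋(x') dμ(x) and R_PN(f) = ∫∫ l01(f(x), f(x')) dμ₋(x') dμ₊(x). -/

import Mathlib

open MeasureTheory

/-- The zero-one pairwise loss `l01(u,v) = (1 - sign(u - v))/2`, with `sign 0 = 0`. -/
noncomputable def l01 (u v : ℝ) : ℝ := (1 - Real.sign (u - v)) / 2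

theorem measurable_l01 : Measurable (Function.uncurry l01) := by
  have hs : Measurable Real.sign :=
    Measurable.ite measurableSet_Iio measurable_const
      (Measurable.ite measurableSet_Ioi measurable_const measurable_const)
  exact (measurable_const.sub (hs.comp (measurable_fst.sub measurable_snd))).div_const 2

theorem norm_l01_le_one (u v : ℝ) : ‖l01 u v‖ ≤ 1 := by
  rcases Real.sign_apply_eq (u - v) with h | h | h <;> norm_num [l01, h]

theorem l01_add_l01_swap (u v : ℝ) : l01 u v + l01 v u = 1 := by
  have h : Real.sign (v - u) = -Real.sign (u - v) := by rw [← neg_sub, Real.sign_neg]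
  rw [l01, l01, h]
  ring

theorem integrable_l01_prod {X : Type*} [MeasurableSpace X] (μ ν : Measure X)
    [IsFiniteMeasure μ] [IsFiniteMeasure ν] {f : X → ℝ} (hf : Measurable f) :
    Integrable (fun p : X × X ↦ l01 (f p.1) (f p.2)) (μ.prod ν) :=
  .of_bound (measurable_l01.comp
    ((hf.comp measurable_fst).prodMk (hf.comp measurable_snd))).aestronglyMeasurable 1
    (.of_forall fun p ↦ norm_l01_le_one (f p.1) (f p.2))

/-- Two independent draws from the same distribution have pairwise risk `1 / 2`. -/
theorem integral_integral_l01_self {X : Type*} [MeasurableSpace X] (ν : Measure X)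
    [IsProbabilityMeasure ν] {f : X → ℝ} (hf : Measurable f) :
    ∫ x, ∫ x', l01 (f x) (f x') ∂ν ∂ν = 1 / 2 := by
  have hi := integrable_l01_prod ν ν hf
  have hswap : ∫ p : X × X, l01 (f p.2) (f p.1) ∂ν.prod ν
      = ∫ p : X × X, l01 (f p.1) (f p.2) ∂ν.prod ν :=
    integral_prod_swap fun p : X × X ↦ l01 (f p.1) (f p.2)
  have hadd := integral_add hi hi.swap
  simp only [Function.comp_apply, Prod.fst_swap, Prod.snd_swap, l01_add_l01_swap, hswap,
    integral_const, probReal_univ, one_smul] at hadd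
  rw [← integral_prod _ hi]
  linarith

/-- The NU AUC risk is a linear transformation of the PN AUC risk:
`R_NU(f) = (1 - π)/2 + π · R_PN(f)`, where the unlabeled marginal is
`μ = π·μ₊ + (1 - π)·μ₋`. -/
theorem R_NU_eq_linear_transform_R_PN {X : Type*} [MeasurableSpace X]
    (μp μn μ : Measure X) [IsProbabilityMeasure μp] [IsProbabilityMeasure μn]
    (π : ℝ) (hπ0 : 0 ≤ π) (hπ1 : π ≤ 1)
    (hμ : μ = ENNReal.ofReal π • μp + ENNReal.ofReal (1 - π) • μn)
    (f : X → ℝ) (hf : Measurable f) :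
    ∫ x, ∫ x', l01 (f x) (f x') ∂μn ∂μ
      = (1 - π) / 2 + π * ∫ x, ∫ x', l01 (f x) (f x') ∂μn ∂μp := by
  have hp := (integrable_l01_prod μp μn hf).integral_prod_left
  have hn := (integrable_l01_prod μn μn hf).integral_prod_left
  rw [hμ, integral_add_measure (hp.smul_measure ENNReal.ofReal_ne_top)
    (hn.smul_measure ENNReal.ofReal_ne_top), integral_smul_measure, integral_smul_measure,
    ENNReal.toReal_ofReal hπ0, ENNReal.toReal_ofReal (sub_nonneg.2 hπ1),
    integral_integral_l01_self μn hf, smul_eq_mul, smul_eq_mul]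
  ring
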